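/- arXiv:1406.2111 — 2 statements merged into one kernel-verified Lean document; each statement's English description precedes it below -/
import Mathlib

section
/- For every positive integer k there exists n0 such that for every n ≥ n0 the following holds. In the saturation game (n, C_k), where C_k is the property of being k-vertex-connected, Max has a strategy (regardless of whether he moves first or second) guaranteeing that the graph at the end of the game has at least C(n,2) − 5k·n^{3/2} edges; in particular s(n, C_k) ≥ C(n,2) − 5k·n^{3/2}. -/
open SimpleGraph

/-- The graph obtained from `G` by adding the edge `e`. -/
def addEdge {V : Type*} (G : SimpleGraph V) (e : Sym2 V) : SimpleGraph V :=
  G ⊔ SimpleGraph.fromEdgeSet {e}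

/-- In the saturation game for the monotone property `P`, a move `e` is legal in
position `G` if `e` is a non-loop non-edge of `G` whose addition keeps `P` unsatisfied. -/
def legalMove {V : Type*} (P : SimpleGraph V → Prop) (G : SimpleGraph V) (e : Sym2 V) : Prop :=
  ¬ e.IsDiag ∧ e ∉ G.edgeSet ∧ ¬ P (addEdge G e)

/-- `GameEnsures P Q turn G` : in the saturation game for the property `P`, played from
position `G` where the protagonist is to move iff `turn = true`, the protagonist has a
strategy guaranteeing that the final (`P`-saturated) graph satisfies `Q`. -/
inductive GameEnsures {V : Type*} (P Q : SimpleGraph V → Prop) : Bool → SimpleGraph V → Prop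
  | gameOver (turn : Bool) (G : SimpleGraph V)
      (hend : ∀ e, ¬ legalMove P G e) (hQ : Q G) : GameEnsures P Q turn G
  | protagonistMove (G : SimpleGraph V) (e : Sym2 V) (hl : legalMove P G e)
      (h : GameEnsures P Q false (addEdge G e)) : GameEnsures P Q true G
  | opponentMove (G : SimpleGraph V) (e₀ : Sym2 V) (hl : legalMove P G e₀)
      (h : ∀ e, legalMove P G e → GameEnsures P Q true (addEdge G e)) :
      GameEnsures P Q false G

/-- `G` is `k`-vertex-connected: it has more than `k` vertices and removing any set of
fewer than `k` vertices leaves a connected graph. -/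
def kConnectedProp {V : Type*} [Fintype V] (k : ℕ) (G : SimpleGraph V) : Prop :=
  k < Fintype.card V ∧ ∀ S : Set V, S.ncard < k → (G.induce Sᶜ).Connected

section SaturationGame

variable {V : Type*}

lemma addEdge_adj (G : SimpleGraph V) (a b x y : V) :
    (addEdge G s(a, b)).Adj x y ↔
      G.Adj x y ∨ (((x = a ∧ y = b) ∨ (x = b ∧ y = a)) ∧ x ≠ y) := by
  simp [addEdge]

lemma le_addEdge (G : SimpleGraph V) (e : Sym2 V) : G ≤ addEdge G e := le_sup_left

lemma lt_addEdge {G : SimpleGraph V} {e : Sym2 V} (hd : ¬ e.IsDiag) (he : e ∉ G.edgeSet) :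
    G < addEdge G e := by
  refine lt_of_le_of_ne (le_addEdge G e) fun h => he ?_
  rw [h]
  simp [addEdge, hd]

lemma lt_addEdge_of_legalMove {P : SimpleGraph V → Prop} {G : SimpleGraph V} {e : Sym2 V}
    (h : legalMove P G e) : G < addEdge G e :=
  lt_addEdge h.1 h.2.1

/-- If all saturated supergraphs of a position satisfy the goal, then any way of playing wins. -/
lemma gameEnsures_of_forall_saturated [Finite V] {P Q : SimpleGraph V → Prop} (G : SimpleGraph V)
    (hP : ¬ P G) (hG : ∀ H, G ≤ H → ¬ P H → (∀ e, ¬ legalMove P H e) → Q H) (turn : Bool) :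
    GameEnsures P Q turn G := by
  induction G using WellFoundedGT.induction generalizing turn with
  | ind G ih =>
    by_cases hend : ∀ e, ¬ legalMove P G e
    · exact .gameOver _ _ hend (hG G le_rfl hP hend)
    · push Not at hend
      obtain ⟨e, he⟩ := hend
      have key : ∀ e, legalMove P G e → ∀ t, GameEnsures P Q t (addEdge G e) := fun e he t =>
        ih _ (lt_addEdge_of_legalMove he) he.2.2
          (fun H hH => hG H ((le_addEdge G e).trans hH)) t
      cases turn with
      | true => exact .protagonistMove _ e he (key e he _)
      | false => exact .opponentMove _ e he fun e he => key e he _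

/-- A set `B` without edges to the outside of `S ∪ B` is never reached when avoiding `S`. -/
lemma not_connected_induce_compl {G : SimpleGraph V} {S B : Set V} {h b : V} (hhS : h ∉ S)
    (hhB : h ∉ B) (hbS : b ∉ S) (hbB : b ∈ B)
    (hcut : ∀ x ∈ B, ∀ y, y ∉ S → y ∉ B → ¬ G.Adj x y) : ¬ (G.induce Sᶜ).Connected := by
  intro hc
  obtain ⟨p⟩ := hc.preconnected ⟨h, hhS⟩ ⟨b, hbS⟩
  have key : ∀ (u v : (Sᶜ : Set V)) (_ : (G.induce Sᶜ).Walk u v), (u : V) ∉ B → (v : V) ∉ B := by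
    intro u v p
    induction p with
    | nil => exact id
    | @cons u v w huv _ ih =>
      exact fun hu => ih fun hv => hcut v hv u u.2 hu (huv.symm)
  exact key _ _ p hhB hbB

/-- Every separation of `G` by fewer than `k` vertices leaves at most `d` vertices apart from
one of the vertices of `K`. -/
def Anchored (k d : ℕ) (K : Finset V) (G : SimpleGraph V) : Prop :=
  ∀ (S : Set V) (B : Finset V) (h : V), S.ncard < k → h ∈ K → h ∉ S → h ∉ B →
    (∀ b ∈ B, b ∉ S) → (∀ x ∈ B, ∀ y, y ∉ S → y ∉ B → ¬ G.Adj x y) → B.card ≤ d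

lemma Anchored.mono {k d : ℕ} {K : Finset V} {G H : SimpleGraph V} (hG : Anchored k d K G)
    (hGH : G ≤ H) : Anchored k d K H :=
  fun S B h h1 h2 h3 h4 h5 h6 => hG S B h h1 h2 h3 h4 h5 fun x hx y hy hy' hadj =>
    h6 x hx y hy hy' (hGH hadj)

open Classical in
/-- The pairs of `K × M` that are not yet edges. -/
noncomputable def missing (K M : Finset V) (G : SimpleGraph V) : Finset (V × V) :=
  (K ×ˢ M).filter fun q => ¬ G.Adj q.1 q.2

lemma mem_missing {K M : Finset V} {G : SimpleGraph V} {x y : V} :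
    (x, y) ∈ missing K M G ↔ (x ∈ K ∧ y ∈ M) ∧ ¬ G.Adj x y := by
  simp [missing]

lemma card_missing_le_of_le {K M : Finset V} {G H : SimpleGraph V} (h : G ≤ H) :
    (missing K M H).card ≤ (missing K M G).card := by
  refine Finset.card_le_card ?_
  rintro ⟨x, y⟩ hxy
  rw [mem_missing] at hxy ⊢
  exact ⟨hxy.1, fun hadj => hxy.2 (h hadj)⟩

lemma card_missing_addEdge_lt {K M : Finset V} {G : SimpleGraph V} {x y : V} (hne : x ≠ y)
    (hxy : (x, y) ∈ missing K M G) :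
    (missing K M (addEdge G s(x, y))).card < (missing K M G).card := by
  refine Finset.card_lt_card ⟨?_, fun h => ?_⟩
  · rintro ⟨u, v⟩ huv
    rw [mem_missing] at huv ⊢
    exact ⟨huv.1, fun hadj => huv.2 (le_addEdge _ _ hadj)⟩
  · have := (mem_missing.1 (h hxy)).2
    rw [addEdge_adj] at this
    tauto

variable [Fintype V]

lemma exists_mem_notMem_of_ncard_lt {K : Finset V} {S : Set V} {k : ℕ} (hS : S.ncard < k)
    (hK : K.card = k) : ∃ h ∈ K, h ∉ S := by
  by_contra! hc
  have : (K : Set V).ncard ≤ S.ncard := Set.ncard_le_ncard hc (Set.toFinite S)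
  rw [Set.ncard_coe_finset] at this
  omega

/-- The number of edges in a saturated graph with no balanced separation. -/
lemma Anchored.choose_two_le {k d : ℕ} {K : Finset V} {H : SimpleGraph V} (hH : Anchored k d K H)
    (hK : K.card = k) (hV : k < Fintype.card V) (hP : ¬ kConnectedProp k H)
    (hend : ∀ e, ¬ legalMove (kConnectedProp k) H e) :
    (Fintype.card V).choose 2 ≤ H.edgeSet.ncard + Fintype.card V * d := by
  classical
  unfold kConnectedProp at hP
  push Not at hP
  obtain ⟨S, hS, hSc⟩ := hP hV
  obtain ⟨h, hhK, hhS⟩ := exists_mem_notMem_of_ncard_lt hS hK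
  set B : Finset V := Finset.univ.filter fun v =>
    ∃ hv : v ∈ Sᶜ, ¬ (H.induce Sᶜ).Reachable ⟨h, hhS⟩ ⟨v, hv⟩ with hBdef
  have hB : ∀ v, v ∈ B ↔ ∃ hv : v ∈ Sᶜ, ¬ (H.induce Sᶜ).Reachable ⟨h, hhS⟩ ⟨v, hv⟩ := by
    simp [hBdef]
  have hhB : h ∉ B := by
    rw [hB]
    rintro ⟨_, hr⟩
    exact hr (Reachable.refl _)
  have hBS : ∀ b ∈ B, b ∉ S := fun b hb => ((hB b).1 hb).1
  have hcut : ∀ x ∈ B, ∀ y, y ∉ S → y ∉ B → ¬ H.Adj x y := by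
    intro x hx y hyS hyB hadj
    obtain ⟨hxS, hxr⟩ := (hB x).1 hx
    rw [hB] at hyB
    push Not at hyB
    refine hxr ((hyB hyS).trans (Adj.reachable ?_))
    exact hadj.symm
  obtain ⟨b, hb⟩ : ∃ b, b ∈ B := by
    by_contra! hempty
    refine hSc ((connected_iff_exists_forall_reachable _).2 ⟨⟨h, hhS⟩, fun v => ?_⟩)
    by_contra hv
    exact hempty v ((hB v).2 ⟨v.2, hv⟩)
  have hBd : B.card ≤ d := hH S B h hS hhK hhS hhB hBS hcut
  have hmeet : ∀ x y, x ≠ y → ¬ H.Adj x y → x ∈ B ∨ y ∈ B := by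
    intro x y hxy hadj
    by_contra! hc
    refine hend s(x, y) ⟨by simpa using hxy, by simpa using hadj, fun hk => ?_⟩
    refine not_connected_induce_compl (B := (B : Set V)) hhS (by simpa using hhB) (hBS b hb)
      (by simpa using hb) ?_ (hk.2 S hS)
    intro u hu v hvS hvB huv
    rw [Finset.mem_coe] at hu hvB
    rw [addEdge_adj] at huv
    rcases huv with huv | ⟨⟨rfl, _⟩ | ⟨rfl, _⟩, _⟩
    · exact hcut u hu v hvS hvB huv
    · exact hc.1 hu
    · exact hc.2 hu
  have hsub : (⊤ : SimpleGraph V).edgeFinset ⊆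
      H.edgeFinset ∪ (Finset.univ ×ˢ B).image fun q => s(q.1, q.2) := by
    intro e
    induction e with
    | _ x y =>
      intro he
      have hxy : x ≠ y := by simpa using he
      rw [Finset.mem_union]
      by_cases hadj : H.Adj x y
      · left; simpa using hadj
      · right
        rw [Finset.mem_image]
        rcases hmeet x y hxy hadj with hx | hy
        · exact ⟨(y, x), by simpa using hx, Sym2.eq_swap⟩
        · exact ⟨(x, y), by simpa using hy, rfl⟩
  have hcard := (Finset.card_le_card hsub).trans (Finset.card_union_le _ _)
  rw [card_edgeFinset_top_eq_card_choose_two] at hcard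
  have himg : ((Finset.univ ×ˢ B).image fun q : V × V => s(q.1, q.2)).card
      ≤ Fintype.card V * d := by
    refine Finset.card_image_le.trans ?_
    rw [Finset.card_product, Finset.card_univ]
    exact Nat.mul_le_mul_left _ hBd
  have : H.edgeSet.ncard = H.edgeFinset.card := by
    rw [← coe_edgeFinset, Set.ncard_coe_finset]
  omega

open Classical in
/-- The isolated vertices of `G` outside `C`. -/
noncomputable def fresh (C : Finset V) (G : SimpleGraph V) : Finset V :=
  Finset.univ.filter fun v => v ∉ C ∧ ∀ w, ¬ G.Adj v w

lemma mem_fresh {C : Finset V} {G : SimpleGraph V} {v : V} :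
    v ∈ fresh C G ↔ v ∉ C ∧ ∀ w, ¬ G.Adj v w := by
  simp [fresh]

lemma mem_fresh_addEdge {C : Finset V} {G : SimpleGraph V} {a b v : V} (hv : v ∈ fresh C G)
    (ha : v ≠ a) (hb : v ≠ b) : v ∈ fresh C (addEdge G s(a, b)) := by
  rw [mem_fresh] at hv ⊢
  refine ⟨hv.1, fun w hw => ?_⟩
  rw [addEdge_adj] at hw
  have := hv.2 w
  tauto

lemma card_fresh_le_addEdge (C : Finset V) (G : SimpleGraph V) (a b : V) :
    (fresh C G).card ≤ (fresh C (addEdge G s(a, b))).card + 2 := by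
  classical
  have : fresh C G ⊆ fresh C (addEdge G s(a, b)) ∪ {a, b} := by
    intro v hv
    by_cases ha : v = a
    · simp [ha]
    by_cases hb : v = b
    · simp [hb]
    exact Finset.mem_union_left _ (mem_fresh_addEdge hv ha hb)
  exact (Finset.card_le_card this).trans ((Finset.card_union_le _ _).trans
    (Nat.add_le_add_left Finset.card_le_two _))

lemma legalMove_of_fresh {k : ℕ} (hk : 0 < k) {C : Finset V} {G : SimpleGraph V}
    (hF : 3 ≤ (fresh C G).card) {a b : V} (hab : a ≠ b) (hadj : ¬ G.Adj a b) :
    legalMove (kConnectedProp k) G s(a, b) := by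
  classical
  refine ⟨by simpa using hab, by simpa using hadj, fun hc => ?_⟩
  have h1 : 0 < (fresh C (addEdge G s(a, b))).card := by
    have := card_fresh_le_addEdge C G a b
    omega
  obtain ⟨w, hw⟩ := Finset.card_pos.1 h1
  obtain ⟨u, hu⟩ : ∃ u, u ≠ w := by
    rcases eq_or_ne a w with rfl | h
    · exact ⟨b, hab.symm⟩
    · exact ⟨a, h⟩
  refine not_connected_induce_compl (S := ∅) (B := {w}) (h := u) (b := w) (by simp) (by simpa)
    (by simp) (by simp) ?_ (hc.2 ∅ (by simpa using hk))
  rintro x rfl y - -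
  exact (mem_fresh.1 hw).2 y

lemma gameEnsures_false_of_fresh {k : ℕ} (hk : 0 < k) {Q : SimpleGraph V → Prop} {C : Finset V}
    {G : SimpleGraph V} (hF : 3 ≤ (fresh C G).card)
    (h : ∀ a b, legalMove (kConnectedProp k) G s(a, b) →
      GameEnsures (kConnectedProp k) Q true (addEdge G s(a, b))) :
    GameEnsures (kConnectedProp k) Q false G := by
  obtain ⟨a, ha, b, _, hab⟩ := Finset.one_lt_card.1 (show 1 < (fresh C G).card by omega)
  refine .opponentMove _ _ (legalMove_of_fresh hk hF hab ((mem_fresh.1 ha).2 b)) fun e => ?_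
  induction e with
  | _ a b => exact h a b

variable [DecidableEq V]

/-- The invariant kept by Max: the hubs `K` are joined to all of `M`, and every vertex outside
`K ∪ M ∪ J` that is not isolated is joined to its anchor `c v`, or lies in `U` and is matched by
`p` to a vertex that is joined to its anchor. -/
structure Attached (K M J U : Finset V) (c p : V → V) (G : SimpleGraph V) : Prop where
  hub : ∀ x ∈ K, ∀ y ∈ M, G.Adj x y
  cover : ∀ v, v ∉ K ∪ M → v ∉ J → v ∈ fresh (K ∪ M) G ∨ G.Adj v (c v) ∨ v ∈ U
  adj_match : ∀ v ∈ U, G.Adj v (p v)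
  match_anchor : ∀ v ∈ U, G.Adj (p v) (c (p v))
  inj : Set.InjOn p U

lemma Attached.anchored {k m : ℕ} {K M J U : Finset V} {c p : V → V} {G : SimpleGraph V}
    (hG : Attached K M J U c p G) (hc : ∀ v, c v ∈ M)
    (hfib : ∀ y, (Finset.univ.filter fun x => c x = y).card ≤ m) :
    Anchored k (K.card + J.card + (fresh (K ∪ M) G).card + 2 * (k * m) + k) K G := by
  classical
  intro S B h hS hhK hhS hhB hBS hcut
  have hM : ∀ y ∈ M, y ∉ S → y ∉ B := fun y hy hyS hyB =>
    hcut y hyB h hhS hhB (hG.hub h hhK y hy).symm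
  have hanchor : ∀ x ∈ B, G.Adj x (c x) → c x ∈ S := by
    intro x hx hadj
    by_contra hcS
    exact hcut x hx (c x) hcS (hM _ (hc x) hcS) hadj
  set T : Finset V := S.toFinset with hT
  have hTk : T.card ≤ k := by
    rw [hT, ← Set.ncard_eq_toFinset_card']
    omega
  set A : Finset V := Finset.univ.filter fun x => c x ∈ T with hA
  have hAm : A.card ≤ k * m := by
    have : A = T.biUnion fun y => Finset.univ.filter fun x => c x = y := by
      ext x
      simp [hA]
    rw [this]
    exact (Finset.card_biUnion_le_card_mul _ _ m fun y _ => hfib y).trans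
      (Nat.mul_le_mul_right _ hTk)
  have hUB : (U ∩ B).card ≤ k + k * m := by
    have himg : (U ∩ B).image p ⊆ T ∪ A := by
      intro y hy
      obtain ⟨v, hv, rfl⟩ := Finset.mem_image.1 hy
      obtain ⟨hvU, hvB⟩ := Finset.mem_inter.1 hv
      by_cases hS' : p v ∈ S
      · simp [hT, hS']
      · have hpB : p v ∈ B := by
          by_contra hpB
          exact hcut v hvB _ hS' hpB (hG.adj_match v hvU)
        have := hanchor _ hpB (hG.match_anchor v hvU)
        simp [hA, hT, this]
    rw [← Finset.card_image_of_injOn (hG.inj.mono (by simp))]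
    refine (Finset.card_le_card himg).trans ((Finset.card_union_le _ _).trans ?_)
    omega
  have hsub : B ⊆ K ∪ J ∪ fresh (K ∪ M) G ∪ A ∪ (U ∩ B) := by
    intro v hv
    simp only [Finset.mem_union, Finset.mem_inter]
    by_cases hK : v ∈ K
    · simp [hK]
    have hvM : v ∉ M := fun h => hM v h (hBS v hv) hv
    by_cases hJ : v ∈ J
    · simp [hJ]
    rcases hG.cover v (by simp [hK, hvM]) hJ with h | h | h
    · simp [h]
    · have := hanchor v hv h
      simp [hA, hT, this]
    · simp [h, hv]
  have h1 := Finset.card_le_card hsub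
  have h2 := Finset.card_union_le (K ∪ J ∪ fresh (K ∪ M) G ∪ A) (U ∩ B)
  have h3 := Finset.card_union_le (K ∪ J ∪ fresh (K ∪ M) G) A
  have h4 := Finset.card_union_le (K ∪ J) (fresh (K ∪ M) G)
  have h5 := Finset.card_union_le K J
  omega

lemma Attached.of_le {K M J U : Finset V} {c p : V → V} {G H : SimpleGraph V}
    (hG : Attached K M J U c p G) (hGH : G ≤ H)
    (hcover : ∀ v ∈ fresh (K ∪ M) G, v ∈ fresh (K ∪ M) H ∨ H.Adj v (c v)) :
    Attached K M J U c p H where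
  hub x hx y hy := hGH (hG.hub x hx y hy)
  cover v hv hvJ := by
    rcases hG.cover v hv hvJ with h | h | h
    · have := hcover v h
      tauto
    · exact Or.inr (Or.inl (hGH h))
    · exact Or.inr (Or.inr h)
  adj_match v hv := hGH (hG.adj_match v hv)
  match_anchor v hv := hGH (hG.match_anchor v hv)
  inj := hG.inj

/-- Max answers by joining some vertex to its anchor: an endpoint of the last edge that was
isolated before, if there is one, and any isolated vertex otherwise. -/
lemma Attached.exists_response {K M J U : Finset V} {c p : V → V} {G : SimpleGraph V}
    (hG : Attached K M J U c p G) (hc : ∀ v, c v ∈ M) {a b : V} (hab : a ≠ b)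
    (hF : 3 ≤ (fresh (K ∪ M) G).card) :
    ∃ (x : V) (U' : Finset V) (p' : V → V), x ≠ c x ∧ ¬ (addEdge G s(a, b)).Adj x (c x) ∧
      Attached K M J U' c p' (addEdge (addEdge G s(a, b)) s(x, c x)) := by
  set C := K ∪ M with hC
  set H := addEdge G s(a, b) with hH
  have hcC : ∀ v, c v ∈ C := fun v => Finset.mem_union_right _ (hc v)
  have hne : ∀ v x, v ∈ fresh C G → v ≠ c x := by
    rintro v x hv rfl
    exact (mem_fresh.1 hv).1 (hcC x)
  have hle : ∀ x, G ≤ addEdge H s(x, c x) := fun x => (le_addEdge _ _).trans (le_addEdge _ _)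
  have hatt : ∀ x, x ≠ c x → (addEdge H s(x, c x)).Adj x (c x) := fun x hx => by
    rw [addEdge_adj]
    exact Or.inr ⟨Or.inl ⟨rfl, rfl⟩, hx⟩
  have hstay : ∀ v x, v ∈ fresh C G → v ≠ a → v ≠ b → v ≠ x →
      v ∈ fresh C (addEdge H s(x, c x)) := fun v x hv ha hb hx =>
    mem_fresh_addEdge (mem_fresh_addEdge hv ha hb) hx (hne v x hv)
  by_cases hboth : a ∈ fresh C G ∧ b ∈ fresh C G
  · obtain ⟨ha, hb⟩ := hboth
    have hbU : b ∉ U := fun h => (mem_fresh.1 hb).2 _ (hG.adj_match b h)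
    have haC := hne a a ha
    refine ⟨a, insert b U, Function.update p b a, haC, ?_, ?_⟩
    · rw [hH, addEdge_adj]
      have h1 := (mem_fresh.1 ha).2 (c a)
      have h2 := hne b a hb
      grind
    · have hupd : ∀ v ∈ U, Function.update p b a v = p v := fun v hv =>
        Function.update_of_ne (by rintro rfl; exact hbU hv) _ _
      refine ⟨fun x hx y hy => hle a (hG.hub x hx y hy), ?_, ?_, ?_, ?_⟩
      · intro v hv hvJ
        rcases hG.cover v hv hvJ with h | h | h
        · by_cases hva : v = a
          · subst hva
            exact Or.inr (Or.inl (hatt v haC))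
          by_cases hvb : v = b
          · simp [hvb]
          exact Or.inl (hstay v a h hva hvb hva)
        · exact Or.inr (Or.inl (hle a h))
        · simp [h]
      · intro v hv
        rcases Finset.mem_insert.1 hv with rfl | hv
        · rw [Function.update_self]
          apply le_addEdge
          rw [hH, addEdge_adj]
          exact Or.inr ⟨Or.inr ⟨rfl, rfl⟩, hab.symm⟩
        · rw [hupd v hv]
          exact hle a (hG.adj_match v hv)
      · intro v hv
        rcases Finset.mem_insert.1 hv with rfl | hv
        · rw [Function.update_self]
          exact hatt a haC
        · rw [hupd v hv]
          exact hle a (hG.match_anchor v hv)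
      · have hpa : ∀ v ∈ U, p v ≠ a := fun v hv h =>
          (mem_fresh.1 ha).2 v (h ▸ hG.adj_match v hv).symm
        rw [Finset.coe_insert, Set.injOn_insert (by simpa using hbU)]
        refine ⟨hG.inj.congr fun v hv => (hupd v hv).symm, ?_⟩
        rintro ⟨v, hv, h⟩
        rw [Function.update_self, hupd v hv] at h
        exact hpa v hv h
  · have hx : ∃ x ∈ fresh C G, ¬ H.Adj x (c x) ∧
        ∀ v ∈ fresh C G, (v = a ∨ v = b) → v ≠ x → H.Adj v (c v) := by
      by_cases hex : ∃ x ∈ fresh C G, (x = a ∨ x = b) ∧ ¬ H.Adj x (c x)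
      · obtain ⟨x, hx, hxab, hadj⟩ := hex
        refine ⟨x, hx, hadj, fun v hv hvab hvx => ?_⟩
        grind
      · push Not at hex
        have hpos : 0 < (fresh C H).card := by
          have : _ ≤ (fresh C H).card + 2 := card_fresh_le_addEdge C G a b
          omega
        obtain ⟨x, hx⟩ := Finset.card_pos.1 hpos
        rw [mem_fresh] at hx
        refine ⟨x, mem_fresh.2 ⟨hx.1, fun w hw => hx.2 w (le_addEdge _ _ hw)⟩, hx.2 _, ?_⟩
        exact fun v hv hvab _ => hex v hv hvab
    obtain ⟨x, hxF, hadj, hrest⟩ := hx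
    refine ⟨x, U, p, hne x x hxF, hadj, hG.of_le (hle x) fun v hv => ?_⟩
    by_cases hvx : v = x
    · subst hvx
      exact Or.inr (hatt v (hne v v hv))
    by_cases hvab : v = a ∨ v = b
    · exact Or.inr (le_addEdge _ _ (hrest v hv hvab hvx))
    · push Not at hvab
      exact Or.inl (hstay v x hv hvab.1 hvab.2 hvx)

/-- Once the hubs are joined to all of `M`, Max keeps the invariant until almost all vertices
have been attached. -/
lemma Attached.gameEnsures {k m d : ℕ} (hk : 0 < k) {Q : SimpleGraph V → Prop}
    {K M J U : Finset V} {c p : V → V} {G : SimpleGraph V} (hG : Attached K M J U c p G)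
    (hP : ¬ kConnectedProp k G) (hc : ∀ v, c v ∈ M)
    (hfib : ∀ y, (Finset.univ.filter fun x => c x = y).card ≤ m)
    (hd : K.card + J.card + 5 + 2 * (k * m) + k ≤ d)
    (hQ : ∀ H, Anchored k d K H → ¬ kConnectedProp k H →
      (∀ e, ¬ legalMove (kConnectedProp k) H e) → Q H) :
    GameEnsures (kConnectedProp k) Q false G := by
  induction G using WellFoundedGT.induction generalizing U p with
  | ind G ih =>
    by_cases hF : (fresh (K ∪ M) G).card ≤ 5
    · refine gameEnsures_of_forall_saturated G hP (fun H hGH => hQ H ?_) _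
      intro S B h h1 h2 h3 h4 h5 h6
      have := (hG.anchored (k := k) hc hfib).mono hGH S B h h1 h2 h3 h4 h5 h6
      omega
    · refine gameEnsures_false_of_fresh hk (C := K ∪ M) (by omega) fun a b hab => ?_
      obtain ⟨x, U', p', hx, hadj, hA⟩ := hG.exists_response hc (a := a) (b := b)
        (by simpa using hab.1) (by omega)
      have h3 : 3 ≤ (fresh (K ∪ M) (addEdge G s(a, b))).card := by
        have := card_fresh_le_addEdge (K ∪ M) G a b
        omega
      have hleg := legalMove_of_fresh hk h3 hx hadj
      exact .protagonistMove _ _ hleg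
        (ih _ ((lt_addEdge_of_legalMove hab).trans (lt_addEdge_of_legalMove hleg)) hA hleg.2.2)

/-- Max first joins the hubs to all of `M`, while enough vertices stay isolated. -/
lemma gameEnsures_true_of_missing {k m d D : ℕ} (hk : 0 < k) {Q : SimpleGraph V → Prop}
    {K M : Finset V} {c : V → V} (hKM : Disjoint K M) (G : SimpleGraph V)
    (hP : ¬ kConnectedProp k G) (hc : ∀ v, c v ∈ M)
    (hfib : ∀ y, (Finset.univ.filter fun x => c x = y).card ≤ m)
    (hd : K.card + D + 5 + 2 * (k * m) + k ≤ d)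
    (hD : D + 3 ≤ (K ∪ M)ᶜ.card)
    (hG : (K ∪ M)ᶜ.card + 2 * (missing K M G).card ≤ D + (fresh (K ∪ M) G).card)
    (hQ : ∀ H, Anchored k d K H → ¬ kConnectedProp k H →
      (∀ e, ¬ legalMove (kConnectedProp k) H e) → Q H) :
    GameEnsures (kConnectedProp k) Q true G := by
  induction G using WellFoundedGT.induction with
  | ind G ih =>
    have hF : 3 ≤ (fresh (K ∪ M) G).card := by omega
    rcases Finset.eq_empty_or_nonempty (missing K M G) with hmis | ⟨⟨x, y⟩, hxy⟩
    · obtain ⟨x, hx⟩ := Finset.card_pos.1 (show 0 < (fresh (K ∪ M) G).card by omega)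
      have hxC := (mem_fresh.1 hx).1
      have hne : ∀ v, v ∉ K ∪ M → v ≠ c x := by
        rintro v hv rfl
        exact hv (Finset.mem_union_right _ (hc x))
      have hleg := legalMove_of_fresh hk hF (hne x hxC) ((mem_fresh.1 hx).2 _)
      refine .protagonistMove _ _ hleg ?_
      have hA : Attached K M ((K ∪ M)ᶜ \ fresh (K ∪ M) G) ∅ c id (addEdge G s(x, c x)) := by
        refine ⟨fun u hu v hv => le_addEdge _ _ ?_, fun v hv hvJ => ?_, by simp, by simp, by simp⟩
        · by_contra hadj
          have := mem_missing.2 ⟨⟨hu, hv⟩, hadj⟩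
          simp [hmis] at this
        · have hvF : v ∈ fresh (K ∪ M) G := by
            by_contra hvF
            exact hvJ (Finset.mem_sdiff.2 ⟨Finset.mem_compl.2 hv, hvF⟩)
          by_cases hvx : v = x
          · subst hvx
            refine Or.inr (Or.inl ?_)
            rw [addEdge_adj]
            exact Or.inr ⟨Or.inl ⟨rfl, rfl⟩, hne v hxC⟩
          · exact Or.inl (mem_fresh_addEdge hvF hvx (hne v hv))
      refine hA.gameEnsures hk hleg.2.2 hc hfib ?_ hQ
      have hsub : fresh (K ∪ M) G ⊆ (K ∪ M)ᶜ := fun v hv =>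
        Finset.mem_compl.2 (mem_fresh.1 hv).1
      rw [Finset.card_sdiff_of_subset hsub]
      omega
    · obtain ⟨⟨hxK, hyM⟩, hadj⟩ := mem_missing.1 hxy
      have hne : x ≠ y := by
        rintro rfl
        exact Finset.disjoint_left.1 hKM hxK hyM
      have hleg := legalMove_of_fresh hk hF hne hadj
      refine .protagonistMove _ _ hleg ?_
      have hlt := card_missing_addEdge_lt hne hxy
      have hfr : (fresh (K ∪ M) G).card ≤ (fresh (K ∪ M) (addEdge G s(x, y))).card := by
        refine Finset.card_le_card fun v hv => mem_fresh_addEdge hv ?_ ?_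
        · rintro rfl
          exact (mem_fresh.1 hv).1 (Finset.mem_union_left _ hxK)
        · rintro rfl
          exact (mem_fresh.1 hv).1 (Finset.mem_union_right _ hyM)
      refine gameEnsures_false_of_fresh hk (C := K ∪ M) (by omega) fun a b hab => ?_
      refine ih _ ((lt_addEdge_of_legalMove hleg).trans (lt_addEdge_of_legalMove hab)) hab.2.2 ?_
      have h1 := card_fresh_le_addEdge (K ∪ M) (addEdge G s(x, y)) a b
      have h2 := card_missing_le_of_le (K := K) (M := M) (le_addEdge (addEdge G s(x, y)) s(a, b))
      omega

lemma gameEnsures_bot {k m d : ℕ} (hk : 0 < k) {Q : SimpleGraph V → Prop}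
    {K M : Finset V} {c : V → V} (hKM : Disjoint K M) (hc : ∀ v, c v ∈ M)
    (hfib : ∀ y, (Finset.univ.filter fun x => c x = y).card ≤ m)
    (hd : K.card + 2 * (K.card * M.card) + 7 + 2 * (k * m) + k ≤ d)
    (hD : 2 * (K.card * M.card) + 5 ≤ (K ∪ M)ᶜ.card)
    (hQ : ∀ H, Anchored k d K H → ¬ kConnectedProp k H →
      (∀ e, ¬ legalMove (kConnectedProp k) H e) → Q H) (turn : Bool) :
    GameEnsures (kConnectedProp k) Q turn ⊥ := by
  have hfresh : fresh (K ∪ M) (⊥ : SimpleGraph V) = (K ∪ M)ᶜ := by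
    ext v
    simp [mem_fresh]
  have hmis : ∀ G, (missing K M G).card ≤ K.card * M.card := fun G => by
    rw [← Finset.card_product]
    refine Finset.card_le_card ?_
    rintro ⟨x, y⟩ hxy
    exact Finset.mem_product.2 (mem_missing.1 hxy).1
  have hF : 3 ≤ (fresh (K ∪ M) (⊥ : SimpleGraph V)).card := by rw [hfresh]; omega
  cases turn with
  | true =>
    have hP : ¬ kConnectedProp k (⊥ : SimpleGraph V) := by
      intro hcon
      obtain ⟨a, ha, b, hb, hab⟩ := Finset.one_lt_card.1 (lt_of_lt_of_le (by norm_num) hF)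
      exact not_connected_induce_compl (S := ∅) (B := {a}) (h := b) (b := a) (by simp)
        (by simpa using hab.symm) (by simp) (by simp) (by simp) (hcon.2 ∅ (by simpa using hk))
    refine gameEnsures_true_of_missing (D := 2 * (K.card * M.card) + 2) hk hKM ⊥ hP hc hfib
      (by omega) (by omega) ?_ hQ
    have := hmis ⊥
    rw [hfresh]
    omega
  | false =>
    refine gameEnsures_false_of_fresh hk hF fun a b hab => ?_
    refine gameEnsures_true_of_missing (D := 2 * (K.card * M.card) + 2) hk hKM _ hab.2.2 hc hfib
      (by omega) (by omega) ?_ hQ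
    have h1 := hmis (addEdge ⊥ s(a, b))
    have h2 := card_fresh_le_addEdge (K ∪ M) ⊥ a b
    rw [hfresh] at h2
    omega

end SaturationGame

/-- In the saturation game `(n, C_k)`, Max (moving first or second) can guarantee a final
score of at least `C(n,2) - 5k n^{3/2}`, for every fixed `k ≥ 1` and all large `n`. -/
theorem statement_0 (k : ℕ) (hk : 0 < k) :
    ∃ n0 : ℕ, ∀ n : ℕ, n0 ≤ n → ∀ turn : Bool,
      GameEnsures (kConnectedProp k)
        (fun G : SimpleGraph (Fin n) =>
          (n.choose 2 : ℝ) - 5 * k * (n : ℝ) ^ ((3 : ℝ) / 2) ≤ (G.edgeSet.ncard : ℝ))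
        turn ⊥ := by
  refine ⟨(100 * k) ^ 2, fun n hn turn => ?_⟩
  set s := Nat.sqrt n with hs
  have hks : 100 * k ≤ s := Nat.le_sqrt'.2 hn
  have hsn : s * s ≤ n := Nat.sqrt_le n
  have hns : n < (s + 1) * (s + 1) := Nat.lt_succ_sqrt n
  have hbig : 100 * (k * s) ≤ n := by nlinarith
  have hkss : s ≤ k * s := Nat.le_mul_of_pos_left _ hk
  have hksk : k ≤ k * s := Nat.le_mul_of_pos_right _ (by omega)
  set K : Finset (Fin n) := Finset.univ.filter fun v => (v : ℕ) < k with hK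
  set M : Finset (Fin n) := Finset.univ.filter fun v => k ≤ (v : ℕ) ∧ (v : ℕ) < k + (s + 1)
    with hM
  have hdiv : ∀ v : Fin n, (v : ℕ) / (s + 1) < s + 1 := fun v =>
    Nat.div_lt_of_lt_mul (v.2.trans hns)
  let c : Fin n → Fin n := fun v => ⟨k + (v : ℕ) / (s + 1), by have := hdiv v; omega⟩
  have hKcard : K.card = k := by
    rw [hK, Fin.card_filter_val_lt]
    omega
  have hKM : Disjoint K M := by
    rw [Finset.disjoint_left]
    intro v hv hv'
    simp only [hK, hM, Finset.mem_filter, Finset.mem_univ, true_and] at hv hv'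
    omega
  have hMcard : M.card = s + 1 := by
    have hunion : K ∪ M = Finset.univ.filter fun v : Fin n => (v : ℕ) < k + (s + 1) := by
      ext v
      simp only [hK, hM, Finset.mem_union, Finset.mem_filter, Finset.mem_univ, true_and]
      omega
    have := Finset.card_union_of_disjoint hKM
    rw [hunion, Fin.card_filter_val_lt, hKcard] at this
    omega
  have hc : ∀ v, c v ∈ M := fun v => by
    have := hdiv v
    simp only [hM, c, Finset.mem_filter, Finset.mem_univ, true_and]
    exact ⟨Nat.le_add_right _ _, Nat.add_lt_add_left this _⟩
  have hfib : ∀ y, (Finset.univ.filter fun x => c x = y).card ≤ s + 1 := by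
    intro y
    rw [← Finset.card_range (s + 1)]
    refine Finset.card_le_card_of_injOn (fun x : Fin n => (x : ℕ) % (s + 1)) ?_ ?_
    · intro x _
      simpa using Nat.mod_lt _ (Nat.succ_pos s)
    · intro x hx x' hx' h
      simp only [Finset.coe_filter, Finset.mem_univ, true_and, Set.mem_ofPred_eq] at hx hx'
      have hq : (x : ℕ) / (s + 1) = (x' : ℕ) / (s + 1) := by
        have := congrArg Fin.val (hx.trans hx'.symm)
        simpa [c] using this
      have h' : (x : ℕ) % (s + 1) = (x' : ℕ) % (s + 1) := h
      apply Fin.ext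
      rw [← Nat.div_add_mod (x : ℕ) (s + 1), ← Nat.div_add_mod (x' : ℕ) (s + 1), hq, h']
  have hcompl : n ≤ (K ∪ M)ᶜ.card + (k + (s + 1)) := by
    have h1 := Finset.card_union_le K M
    have h2 := Finset.card_add_card_compl (K ∪ M)
    rw [Fintype.card_fin] at h2
    omega
  refine gameEnsures_bot (m := s + 1) (d := 4 * (k * (s + 1)) + 2 * k + 7) hk hKM hc hfib
    ?_ ?_ ?_ turn
  · rw [hKcard, hMcard]
    omega
  · rw [hKcard, hMcard]
    have : k * (s + 1) = k * s + k := by ring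
    omega
  · intro H hA hP hend
    have hcount := hA.choose_two_le hKcard (by rw [Fintype.card_fin]; omega) hP hend
    rw [Fintype.card_fin] at hcount
    have hd : 4 * (k * (s + 1)) + 2 * k + 7 ≤ 5 * k * s := by nlinarith
    have hcount' : (n.choose 2 : ℝ) ≤ H.edgeSet.ncard + n * (5 * k * s) := by
      exact_mod_cast hcount.trans (Nat.add_le_add_left (Nat.mul_le_mul_left _ hd) _)
    have hpow : (n : ℝ) ^ ((3 : ℝ) / 2) = n * √n := by
      have hn0 : (0 : ℝ) < n := by
        have : 0 < n := by omega
        exact_mod_cast this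
      rw [show (3 : ℝ) / 2 = 1 + 1 / 2 by norm_num, Real.rpow_add hn0, Real.rpow_one,
        Real.sqrt_eq_rpow]
    have hsq : (s : ℝ) ≤ √n := Real.nat_sqrt_le_real_sqrt
    have : (n : ℝ) * (5 * k * s) ≤ 5 * k * (n * √n) := by
      have : (n : ℝ) * (5 * k * s) = 5 * k * (n * s) := by ring
      rw [this]
      gcongr
    rw [hpow]
    linarith
end

section
/- For every integer k ≥ 5 there exists n0 such that for every n ≥ n0 the following holds. In the saturation game (n, C_k), where C_k is the property of being k-vertex-connected, Max has a strategy (regardless of whether he moves first or second) guaranteeing that the graph at the end of the game has at least C(n,2) − (k−1)(2k−4)·[n − (k−1)(2k−3)] edges; in particular s(n, C_k) ≥ C(n,2) − (k−1)(2k−4)·[n − (k−1)(2k−3)]. -/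
open SimpleGraph

/-- A separation of order less than `k` with nonempty sides prevents `k`-connectivity. -/
theorem not_kConnectedProp_of_separation {V : Type*} [Fintype V] [DecidableEq V] {k : ℕ}
    {G : SimpleGraph V} {A B : Finset V} (hAB : Disjoint A B) (hA : A.Nonempty)
    (hB : B.Nonempty) (hsep : ∀ a ∈ A, ∀ b ∈ B, ¬ G.Adj a b) (hcard : ((A ∪ B)ᶜ).card < k) :
    ¬ kConnectedProp k G := by
  rintro ⟨-, h⟩
  have hconn := h (↑((A ∪ B)ᶜ) : Set V) (by rwa [Set.ncard_coe_finset])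
  have mem : ∀ x : ↥((↑((A ∪ B)ᶜ) : Set V)ᶜ), x.1 ∈ A ∨ x.1 ∈ B := by
    rintro ⟨x, hx⟩
    simpa [-not_or, or_iff_not_imp_left] using hx
  have key : ∀ x y : ↥((↑((A ∪ B)ᶜ) : Set V)ᶜ),
      (G.induce (↑((A ∪ B)ᶜ) : Set V)ᶜ).Walk x y → x.1 ∈ A → y.1 ∈ A := by
    intro x y p
    induction p with
    | nil => exact id
    | @cons u v w huv p ih =>
      intro hu
      refine ih ((mem v).resolve_right fun hv => hsep _ hu _ hv ?_)
      simpa using huv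
  obtain ⟨a, ha⟩ := hA
  obtain ⟨b, hb⟩ := hB
  obtain ⟨p⟩ := hconn.preconnected ⟨a, by simp [ha]⟩ ⟨b, by simp [hb]⟩
  exact Finset.disjoint_left.mp hAB (key _ _ p ha) hb

/-- A graph on more than `k` vertices that is not `k`-connected has a separation of order
exactly `k - 1` with nonempty sides. -/
theorem exists_separation_of_not_kConnectedProp {V : Type*} [Fintype V] [DecidableEq V] {k : ℕ}
    {G : SimpleGraph V} (hk : k < Fintype.card V) (h : ¬ kConnectedProp k G) :
    ∃ A B : Finset V, Disjoint A B ∧ A.Nonempty ∧ B.Nonempty ∧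
      (∀ a ∈ A, ∀ b ∈ B, ¬ G.Adj a b) ∧ ((A ∪ B)ᶜ).card = k - 1 := by
  classical
  have h' : ∃ S : Set V, S.ncard < k ∧ ¬ (G.induce Sᶜ).Connected := by
    by_contra! hc
    exact h ⟨hk, hc⟩
  obtain ⟨S, hS, hconn⟩ := h'
  have hne : Nonempty ↥Sᶜ := by
    by_contra hempty
    have hall : S = Set.univ := by
      ext x
      by_contra hx
      exact hempty ⟨⟨x, by simpa using hx⟩⟩
    rw [hall, Set.ncard_univ, Nat.card_eq_fintype_card] at hS
    omega
  have hpre : ¬ (G.induce Sᶜ).Preconnected := fun hp => hconn ⟨hp⟩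
  have huv : ∃ u v, ¬ (G.induce Sᶜ).Reachable u v := by
    by_contra! hc
    exact hpre hc
  obtain ⟨u, v, huv⟩ := huv
  have hne_uv : u.1 ≠ v.1 := fun he => huv (Subtype.ext he ▸ SimpleGraph.Reachable.refl u)
  have hScard : S.toFinset.card ≤ k - 1 := by
    rw [← Set.ncard_eq_toFinset_card']
    omega
  have hsub : S.toFinset ⊆ ({u.1, v.1} : Finset V)ᶜ := by
    intro x hx
    simp only [Set.mem_toFinset] at hx
    simp only [Finset.mem_compl, Finset.mem_insert, Finset.mem_singleton, not_or]
    exact ⟨fun he => u.2 (he ▸ hx), fun he => v.2 (he ▸ hx)⟩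
  obtain ⟨T, hST, hT, hTcard⟩ := Finset.exists_subsuperset_card_eq hsub hScard (by
    rw [Finset.card_compl, Finset.card_pair hne_uv]
    omega)
  have hST' : ∀ x, x ∈ S → x ∈ T := fun x hx => hST (by simpa using hx)
  have huT : u.1 ∉ T := fun hu => by simpa using hT hu
  have hvT : v.1 ∉ T := fun hv => by simpa using hT hv
  refine ⟨Finset.univ.filter fun x => x ∉ T ∧ ∃ hx : x ∈ Sᶜ, (G.induce Sᶜ).Reachable u ⟨x, hx⟩,
    Finset.univ.filter fun x => x ∉ T ∧ ¬ ∃ hx : x ∈ Sᶜ, (G.induce Sᶜ).Reachable u ⟨x, hx⟩,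
    ?_, ⟨u, ?_⟩, ⟨v, ?_⟩, ?_, ?_⟩
  · rw [Finset.disjoint_left]
    intro x hx hx'
    simp only [Finset.mem_filter, Finset.mem_univ, true_and] at hx hx'
    exact hx'.2 hx.2
  · simp only [Finset.mem_filter, Finset.mem_univ, true_and]
    exact ⟨huT, u.2, SimpleGraph.Reachable.refl u⟩
  · simp only [Finset.mem_filter, Finset.mem_univ, true_and]
    exact ⟨hvT, fun ⟨_, hr⟩ => huv hr⟩
  · intro a ha b hb hadj
    simp only [Finset.mem_filter, Finset.mem_univ, true_and] at ha hb
    obtain ⟨-, haS, hr⟩ := ha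
    have hbS : b ∈ Sᶜ := fun hbS => hb.1 (hST' b hbS)
    refine hb.2 ⟨hbS, hr.trans (SimpleGraph.Adj.reachable ?_)⟩
    simpa using hadj
  · rw [← hTcard]
    congr 1
    ext x
    simp only [Finset.mem_compl, Finset.mem_union, Finset.mem_filter, Finset.mem_univ, true_and]
    tauto

/-- Every vertex of a `k`-connected graph has degree at least `k`. -/
theorem kConnectedProp.le_degree {V : Type*} [Fintype V] {k : ℕ} {G : SimpleGraph V}
    [DecidableRel G.Adj] (h : kConnectedProp k G) (v : V) : k ≤ G.degree v := by
  classical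
  by_contra! hv
  have hdis : Disjoint {v} (insert v (G.neighborFinset v))ᶜ := by simp
  have hins : (insert v (G.neighborFinset v)).card = G.degree v + 1 := by
    rw [Finset.card_insert_of_notMem (by simp), SimpleGraph.card_neighborFinset_eq_degree]
  have heq : ({v} ∪ (insert v (G.neighborFinset v))ᶜ)ᶜ = G.neighborFinset v := by
    ext x
    by_cases hx : x = v <;> simp [hx]
  refine not_kConnectedProp_of_separation hdis (Finset.singleton_nonempty v) ?_ ?_ ?_ h
  · rw [← Finset.card_pos, Finset.card_compl, hins]
    have := h.1
    omega
  · intro a ha b hb hadj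
    rw [Finset.mem_singleton] at ha
    subst ha
    simp [hadj] at hb
  · rwa [heq, SimpleGraph.card_neighborFinset_eq_degree]

/-- A graph whose degree sum is less than `k` times the number of vertices is not
`k`-connected. -/
theorem not_kConnectedProp_of_edgeSet_ncard {V : Type*} [Fintype V] {k : ℕ} {G : SimpleGraph V}
    (h : 2 * G.edgeSet.ncard < k * Fintype.card V) : ¬ kConnectedProp k G := by
  classical
  intro hk
  have hsum := G.sum_degrees_eq_twice_card_edges
  have hle : ∑ _v : V, k ≤ ∑ v, G.degree v := Finset.sum_le_sum fun v _ => hk.le_degree v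
  rw [Finset.sum_const, Finset.card_univ, smul_eq_mul, hsum, mul_comm,
    ← SimpleGraph.coe_edgeFinset, Set.ncard_coe_finset] at *
  omega

theorem edgeSet_addEdge {V : Type*} (G : SimpleGraph V) {e : Sym2 V} (he : ¬ e.IsDiag) :
    (addEdge G e).edgeSet = insert e G.edgeSet := by
  ext x
  simp only [addEdge, SimpleGraph.edgeSet_sup, SimpleGraph.edgeSet_fromEdgeSet, Set.mem_union,
    Set.mem_sdiff, Set.mem_singleton_iff, Set.mem_insert_iff]
  constructor
  · tauto
  · rintro (rfl | h)
    · exact Or.inr ⟨rfl, he⟩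
    · exact Or.inl h

/-- If graphs with at most `τ` edges fail `P`, then the protagonist can force every edge of a
set `E` with `2 * #E < τ` into the final graph. -/
theorem gameEnsures_of_forcing {V : Type*} [Fintype V] [DecidableEq V]
    {P Q : SimpleGraph V → Prop} {E : Finset (Sym2 V)} (hE : ∀ e ∈ E, ¬ e.IsDiag) {τ : ℕ}
    (hτ : ∀ G : SimpleGraph V, G.edgeSet.ncard ≤ τ → ¬ P G)
    (hQ : ∀ G : SimpleGraph V, ¬ P G → (∀ e, ¬ legalMove P G e) → ↑E ⊆ G.edgeSet → Q G)
    (N : ℕ) (turn : Bool) (G : SimpleGraph V) (hN : G.edgeSetᶜ.ncard ≤ N) (hG : ¬ P G)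
    (hinv : ↑E ⊆ G.edgeSet ∨
      G.edgeSet.ncard + 2 * (↑E \ G.edgeSet : Set (Sym2 V)).ncard + (if turn then 0 else 1) ≤ τ) :
    GameEnsures P Q turn G := by
  induction N generalizing turn G with
  | zero =>
    have hnot : ∀ e, ¬ legalMove P G e := by
      intro e he
      have hpos : 0 < G.edgeSetᶜ.ncard := (Set.ncard_pos (Set.toFinite _)).2 ⟨e, he.2.1⟩
      omega
    refine .gameOver _ _ hnot (hQ G hG hnot fun e he => ?_)
    by_contra hne
    have hpos : 0 < G.edgeSetᶜ.ncard := (Set.ncard_pos (Set.toFinite _)).2 ⟨e, hne⟩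
    omega
  | succ N ih =>
    have hdec : ∀ e, legalMove P G e → (addEdge G e).edgeSetᶜ.ncard ≤ N := by
      intro e he
      have hlt : (addEdge G e).edgeSetᶜ.ncard < G.edgeSetᶜ.ncard := by
        refine Set.ncard_lt_ncard ?_ (Set.toFinite _)
        rw [edgeSet_addEdge G he.1]
        refine ⟨Set.compl_subset_compl.2 (Set.subset_insert _ _), fun hs => ?_⟩
        exact hs (show e ∈ G.edgeSetᶜ from he.2.1) (Set.mem_insert _ _)
      omega
    have hcard : ∀ e, legalMove P G e →
        (addEdge G e).edgeSet.ncard = G.edgeSet.ncard + 1 := by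
      intro e he
      rw [edgeSet_addEdge G he.1, Set.ncard_insert_of_notMem he.2.1 (Set.toFinite _)]
    by_cases hsub : (↑E : Set (Sym2 V)) ⊆ G.edgeSet
    · have hstep : ∀ t e, legalMove P G e → GameEnsures P Q t (addEdge G e) := by
        intro t e he
        refine ih t _ (hdec e he) he.2.2 (Or.inl ?_)
        rw [edgeSet_addEdge G he.1]
        exact hsub.trans (Set.subset_insert _ _)
      by_cases hend : ∀ e, ¬ legalMove P G e
      · exact .gameOver _ _ hend (hQ G hG hend hsub)
      · push Not at hend
        obtain ⟨e, he⟩ := hend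
        cases turn
        · exact .opponentMove G e he fun e' he' => hstep true e' he'
        · exact .protagonistMove G e he (hstep false e he)
    · have hinv' := hinv.resolve_left hsub
      obtain ⟨e, heE, heG⟩ := Set.not_subset.1 hsub
      have hpos : 0 < (↑E \ G.edgeSet : Set (Sym2 V)).ncard :=
        (Set.ncard_pos (Set.toFinite _)).2 ⟨e, heE, heG⟩
      have hediag := hE e heE
      have hlegal : legalMove P G e := by
        refine ⟨hediag, heG, hτ _ ?_⟩
        rw [edgeSet_addEdge G hediag, Set.ncard_insert_of_notMem heG (Set.toFinite _)]
        omega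
      cases turn
      · refine .opponentMove G e hlegal fun e' he' =>
          ih true _ (hdec e' he') he'.2.2 (Or.inr ?_)
        have hle : (↑E \ (addEdge G e').edgeSet : Set (Sym2 V)).ncard ≤
            (↑E \ G.edgeSet : Set (Sym2 V)).ncard := by
          refine Set.ncard_le_ncard ?_ (Set.toFinite _)
          rw [edgeSet_addEdge G he'.1]
          exact Set.sdiff_subset_sdiff_right (Set.subset_insert _ _)
        have := hcard e' he'
        simp only [Bool.false_eq_true, if_false, if_true] at hinv' ⊢
        omega
      · refine .protagonistMove G e hlegal
          (ih false _ (hdec e hlegal) hlegal.2.2 (Or.inr ?_))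
        have hlt : (↑E \ (addEdge G e).edgeSet : Set (Sym2 V)).ncard <
            (↑E \ G.edgeSet : Set (Sym2 V)).ncard := by
          refine Set.ncard_lt_ncard ?_ (Set.toFinite _)
          rw [edgeSet_addEdge G hediag]
          refine ⟨Set.sdiff_subset_sdiff_right (Set.subset_insert _ _), fun hs => ?_⟩
          exact (hs ⟨heE, heG⟩).2 (Set.mem_insert _ _)
        have := hcard e hlegal
        simp only [Bool.false_eq_true, if_false, if_true] at hinv' ⊢
        omega

/-- In a saturated graph the non-edges all run between the two sides of a separation of order
`k - 1`, so the product of the sizes of the sides bounds their number. -/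
theorem choose_two_le_of_saturated {V : Type*} [Fintype V] [DecidableEq V] {k : ℕ} (hk : 0 < k)
    {G : SimpleGraph V} {A B : Finset V} (hAB : Disjoint A B) (hA : A.Nonempty)
    (hB : B.Nonempty) (hsep : ∀ a ∈ A, ∀ b ∈ B, ¬ G.Adj a b)
    (hcard : ((A ∪ B)ᶜ).card = k - 1) (hsat : ∀ e, ¬ legalMove (kConnectedProp k) G e) :
    (Fintype.card V).choose 2 ≤ G.edgeSet.ncard + A.card * B.card := by
  classical
  have hcover : ((⊤ : SimpleGraph V).edgeFinset) ⊆
      G.edgeFinset ∪ (A ×ˢ B).image fun p => s(p.1, p.2) := by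
    intro e he
    by_contra hne
    simp only [Finset.mem_union, SimpleGraph.mem_edgeFinset, Finset.mem_image,
      Finset.mem_product, not_or] at hne
    obtain ⟨heG, heAB⟩ := hne
    have hdiag : ¬ e.IsDiag := by simpa using he
    refine hsat e ⟨hdiag, heG, not_kConnectedProp_of_separation hAB hA hB ?_ (by omega)⟩
    intro a ha b hb hadj
    rw [← SimpleGraph.mem_edgeSet, edgeSet_addEdge G hdiag, Set.mem_insert_iff] at hadj
    rcases hadj with hadj | hadj
    · exact heAB ⟨(a, b), ⟨ha, hb⟩, hadj⟩
    · exact hsep a ha b hb hadj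
  have hle := (Finset.card_le_card hcover).trans (Finset.card_union_le _ _)
  rw [SimpleGraph.card_edgeFinset_top_eq_card_choose_two] at hle
  have himg : ((A ×ˢ B).image fun p => s(p.1, p.2)).card ≤ A.card * B.card :=
    Finset.card_image_le.trans (Finset.card_product A B).le
  have hGc : G.edgeSet.ncard = G.edgeFinset.card := by
    rw [← SimpleGraph.coe_edgeFinset, Set.ncard_coe_finset]
  omega

/-- Vertices of the graph forced by Max: `k` hubs, `m` gadgets made of `k` cells with four
vertices each, and `r` further vertices. -/
abbrev HubVertex (k m r : ℕ) : Type := Fin k ⊕ (Fin m × Fin k × Fin 4) ⊕ Fin r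

namespace HubVertex

variable {k m r : ℕ}

/-- The `i`-th hub. -/
abbrev hub (i : Fin k) : HubVertex k m r := Sum.inl i

/-- The `a`-th vertex of the `i`-th cell of gadget `g`; its centre is the one with `a = 0`. -/
abbrev cell (g : Fin m) (i : Fin k) (a : Fin 4) : HubVertex k m r := Sum.inr (Sum.inl (g, i, a))

/-- The `j`-th vertex outside the gadgets. -/
abbrev extra (j : Fin r) : HubVertex k m r := Sum.inr (Sum.inr j)

/-- Leaves of a cell are joined to its centre, the centre of the `i`-th cell to the `i`-th hub,
the centres of a gadget form a star centred at that of cell `i₀`, and the extra vertices are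
joined to all hubs. -/
def edges (i₀ : Fin k) : Finset (Sym2 (HubVertex k m r)) :=
  (Finset.univ.image fun p : Fin m × Fin k × Fin 4 =>
      s(cell p.1 p.2.1 p.2.2, if p.2.2 = 0 then hub p.2.1 else cell p.1 p.2.1 0)) ∪
    ((Finset.univ ×ˢ Finset.univ.erase i₀).image fun p : Fin m × Fin k =>
      s(cell p.1 i₀ 0, cell p.1 p.2 0)) ∪
    Finset.univ.image fun p : Fin r × Fin k => s(extra p.1, hub p.2)

theorem not_isDiag_of_mem_edges {i₀ : Fin k} {e : Sym2 (HubVertex k m r)}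
    (he : e ∈ edges i₀) : ¬ e.IsDiag := by
  simp only [edges, Finset.mem_union, Finset.mem_image, Finset.mem_univ, true_and,
    Finset.mem_product, Finset.mem_erase] at he
  rcases he with (⟨⟨g, i, a⟩, rfl⟩ | ⟨⟨g, i⟩, hi, rfl⟩) | ⟨⟨j, i⟩, rfl⟩
  · by_cases ha : a = 0 <;> simp [ha]
  · simpa [eq_comm] using hi
  · simp

theorem card_edges_le (i₀ : Fin k) :
    (edges i₀ : Finset (Sym2 (HubVertex k m r))).card ≤ m * (k * 4) + m * (k - 1) + r * k := by
  refine (Finset.card_union_le _ _).trans (Nat.add_le_add ((Finset.card_union_le _ _).trans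
    (Nat.add_le_add ?_ ?_)) ?_) <;> refine Finset.card_image_le.trans (le_of_eq ?_)
  · simp
  · simp [Finset.card_erase_of_mem]
  · simp


variable {i₀ : Fin k} {G : SimpleGraph (HubVertex k m r)}

theorem adj_centre (hG : ↑(edges i₀ : Finset (Sym2 (HubVertex k m r))) ⊆ G.edgeSet)
    (g : Fin m) (i : Fin k) {a : Fin 4} (ha : a ≠ 0) : G.Adj (cell g i a) (cell g i 0) := by
  refine G.mem_edgeSet.1 (hG (Finset.mem_coe.2 (Finset.mem_union_left _ (Finset.mem_union_left _ ?_))))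
  exact Finset.mem_image.2 ⟨(g, i, a), Finset.mem_univ _, by simp [ha]⟩

theorem adj_hub (hG : ↑(edges i₀ : Finset (Sym2 (HubVertex k m r))) ⊆ G.edgeSet)
    (g : Fin m) (i : Fin k) : G.Adj (cell g i 0) (hub i) := by
  refine G.mem_edgeSet.1 (hG (Finset.mem_coe.2 (Finset.mem_union_left _ (Finset.mem_union_left _ ?_))))
  exact Finset.mem_image.2 ⟨(g, i, 0), Finset.mem_univ _, by simp⟩

theorem adj_main_centre (hG : ↑(edges i₀ : Finset (Sym2 (HubVertex k m r))) ⊆ G.edgeSet)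
    (g : Fin m) {i : Fin k} (hi : i ≠ i₀) : G.Adj (cell g i₀ 0) (cell g i 0) := by
  refine G.mem_edgeSet.1 (hG (Finset.mem_coe.2 (Finset.mem_union_left _ (Finset.mem_union_right _ ?_))))
  exact Finset.mem_image.2 ⟨(g, i), by simp [hi], rfl⟩

theorem adj_extra (hG : ↑(edges i₀ : Finset (Sym2 (HubVertex k m r))) ⊆ G.edgeSet)
    (j : Fin r) (i : Fin k) : G.Adj (extra j) (hub i) := by
  refine G.mem_edgeSet.1 (hG (Finset.mem_coe.2 (Finset.mem_union_right _ ?_)))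
  exact Finset.mem_image.2 ⟨(j, i), Finset.mem_univ _, rfl⟩

/-- All surviving hubs lie in a part `A`, closed under adjacency up to `S`, as soon as `A` contains
a centre of a gadget that avoids `S`. -/
theorem hub_mem_of_centre_mem
    (hG : ↑(edges i₀ : Finset (Sym2 (HubVertex k m r))) ⊆ G.edgeSet)
    {A S : Finset (HubVertex k m r)}
    (hsep : ∀ x y, G.Adj x y → x ∈ A → y ∉ S → y ∈ A) {g : Fin m}
    (hg : ∀ i a, cell g i a ∉ S) {i : Fin k} (hi : cell g i 0 ∈ A) (i' : Fin k)
    (hi' : hub i' ∉ S) : hub i' ∈ A := by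
  have hmain : cell g i₀ 0 ∈ A := by
    by_cases h : i = i₀
    · rwa [← h]
    · exact hsep _ _ (adj_main_centre hG g h).symm hi (hg _ _)
  have hcentre : cell g i' 0 ∈ A := by
    by_cases h : i' = i₀
    · rwa [h]
    · exact hsep _ _ (adj_main_centre hG g h) hmain (hg _ _)
  exact hsep _ _ (adj_hub hG g i') hcentre hi'

theorem exists_hub_notMem {S : Finset (HubVertex k m r)} (hS : S.card < k) :
    ∃ i : Fin k, (hub i : HubVertex k m r) ∉ S := by
  by_contra! h
  have := Finset.card_le_card_of_injOn (s := (Finset.univ : Finset (Fin k))) (t := S)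
    (fun i => hub i) (fun i _ => h i) (fun _ _ _ _ h => Sum.inl_injective h)
  simp at this
  omega

theorem exists_gadget_avoiding {S : Finset (HubVertex k m r)} (hS : S.card < m) :
    ∃ g : Fin m, ∀ i a, (cell g i a : HubVertex k m r) ∉ S := by
  by_contra! h
  choose i a hia using h
  have := Finset.card_le_card_of_injOn (s := (Finset.univ : Finset (Fin m))) (t := S)
    (fun g => cell g (i g) (a g)) (fun g _ => hia g) (fun _ _ _ _ h => by
      simp only [Sum.inr.injEq, Sum.inl.injEq, Prod.mk.injEq] at h
      exact h.1)
  simp at this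
  omega

/-- A side of a separation that contains no hub is small. -/
theorem card_side_le (hG : ↑(edges i₀ : Finset (Sym2 (HubVertex k m r))) ⊆ G.edgeSet)
    {A S : Finset (HubVertex k m r)} (hA : ∀ x ∈ A, x ∉ S)
    (hsep : ∀ x y, G.Adj x y → x ∈ A → y ∉ S → y ∈ A) (hS : S.card < k)
    (hhub : ∀ i, (hub i : HubVertex k m r) ∉ A) :
    ∃ s j, s + j ≤ S.card ∧ A.card ≤ s * (j * 4) + s * 3 := by
  classical
  obtain ⟨i₁, hi₁⟩ := exists_hub_notMem hS
  let J : Finset (Fin k) := Finset.univ.filter fun i => hub i ∈ S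
  let D : Finset (Fin m × Fin k × Fin 4) :=
    Finset.univ.filter fun p => cell p.1 p.2.1 p.2.2 ∈ S
  refine ⟨D.card, J.card, ?_, ?_⟩
  · have hsub : J.disjSum (D.disjSum (∅ : Finset (Fin r))) ⊆ S := by
      rintro (i | p | j) h
      · simpa [J] using h
      · simpa [D] using h
      · simp at h
    have := Finset.card_le_card hsub
    simp only [Finset.card_disjSum, Finset.card_empty] at this
    omega
  · have hcover : A ⊆
        ((D.image fun p => p.1) ×ˢ J ×ˢ (Finset.univ : Finset (Fin 4))).image
          (fun p => cell p.1 p.2.1 p.2.2) ∪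
        ((D.image fun p => (p.1, p.2.1)) ×ˢ (Finset.univ.erase (0 : Fin 4))).image
          (fun p => cell p.1.1 p.1.2 p.2) := by
      rintro (i | ⟨g, i, a⟩ | j) hx
      · exact absurd hx (hhub i)
      · by_cases hc : cell g i 0 ∈ S
        · have ha : a ≠ 0 := by
            rintro rfl
            exact hA _ hx hc
          refine Finset.mem_union_right _ (Finset.mem_image.2 ⟨((g, i), a), ?_, rfl⟩)
          refine Finset.mem_product.2 ⟨Finset.mem_image.2 ⟨(g, i, 0), ?_, rfl⟩, by simp [ha]⟩
          simpa [D] using hc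
        · have hcA : cell g i 0 ∈ A := by
            by_cases ha : a = 0
            · rwa [← ha]
            · exact hsep _ _ (adj_centre hG g i ha) hx hc
          have hiS : hub i ∈ S := by
            by_contra hiS
            exact hhub i (hsep _ _ (adj_hub hG g i) hcA hiS)
          have hg : ∃ i a, cell g i a ∈ S := by
            by_contra! hg
            exact hhub i₁ (hub_mem_of_centre_mem hG hsep hg hcA i₁ hi₁)
          obtain ⟨i', a', hg⟩ := hg
          refine Finset.mem_union_left _ (Finset.mem_image.2 ⟨(g, i, a), ?_, rfl⟩)
          refine Finset.mem_product.2 ⟨Finset.mem_image.2 ⟨(g, i', a'), ?_, rfl⟩,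
            Finset.mem_product.2 ⟨?_, Finset.mem_univ _⟩⟩
          · simpa [D] using hg
          · simpa [J] using hiS
      · exact absurd (hsep _ _ (adj_extra hG j i₁) hx hi₁) (hhub i₁)
    refine (Finset.card_le_card hcover).trans ((Finset.card_union_le _ _).trans
      (Nat.add_le_add ?_ ?_)) <;> refine Finset.card_image_le.trans ?_
    · rw [Finset.card_product, Finset.card_product, Finset.card_univ, Fintype.card_fin]
      exact Nat.mul_le_mul_right _ Finset.card_image_le
    · rw [Finset.card_product, Finset.card_erase_of_mem (Finset.mem_univ _), Finset.card_univ,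
        Fintype.card_fin]
      exact Nat.mul_le_mul_right _ Finset.card_image_le

/-- One of the two sides of any separation of order less than `k` is small. -/
theorem exists_card_side_le (hG : ↑(edges i₀ : Finset (Sym2 (HubVertex k m r))) ⊆ G.edgeSet)
    (hkm : k ≤ m) {A B : Finset (HubVertex k m r)} (hAB : Disjoint A B)
    (hsep : ∀ a ∈ A, ∀ b ∈ B, ¬ G.Adj a b) (hcard : ((A ∪ B)ᶜ).card < k) :
    ∃ s j, s + j ≤ ((A ∪ B)ᶜ).card ∧
      (A.card ≤ s * (j * 4) + s * 3 ∨ B.card ≤ s * (j * 4) + s * 3) := by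
  have hsepA : ∀ x y, G.Adj x y → x ∈ A → y ∉ (A ∪ B)ᶜ → y ∈ A := by
    intro x y hxy hx hy
    simp only [Finset.mem_compl, Finset.mem_union, not_not] at hy
    exact hy.resolve_right fun hyB => hsep x hx y hyB hxy
  have hsepB : ∀ x y, G.Adj x y → x ∈ B → y ∉ (A ∪ B)ᶜ → y ∈ B := by
    intro x y hxy hx hy
    simp only [Finset.mem_compl, Finset.mem_union, not_not] at hy
    exact hy.resolve_left fun hyA => hsep y hyA x hx hxy.symm
  obtain ⟨g, hg⟩ := exists_gadget_avoiding (hcard.trans_le hkm)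
  have hmem := hg i₀ 0
  simp only [Finset.mem_compl, Finset.mem_union, not_not] at hmem
  rcases hmem with hmem | hmem
  · obtain ⟨s, j, hsj, hle⟩ := card_side_le hG (A := B) (S := (A ∪ B)ᶜ)
      (fun x hx => by simp [hx]) hsepB hcard fun i hi =>
        Finset.disjoint_left.1 hAB
          (hub_mem_of_centre_mem hG hsepA hg hmem i (by simp [hi])) hi
    exact ⟨s, j, hsj, Or.inr hle⟩
  · obtain ⟨s, j, hsj, hle⟩ := card_side_le hG (A := A) (S := (A ∪ B)ᶜ)
      (fun x hx => by simp [hx]) hsepA hcard fun i hi =>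
        Finset.disjoint_left.1 hAB hi
          (hub_mem_of_centre_mem hG hsepB hg hmem i (by simp [hi]))
    exact ⟨s, j, hsj, Or.inl hle⟩

end HubVertex

/-- If one of two sides of a separation of order `k - 1` is at most `(k - 1) (2 k - 4)`, the product
of their sizes is at most that of an extremal separation. -/
theorem mul_side_le {k n a b s j : ℤ} (hk : 5 ≤ k) (hn : 2 * (k * (2 * k)) ≤ n) (hj : 0 ≤ j)
    (hsj : s + j ≤ k - 1) (hab : a + b = n - (k - 1))
    (ha : a ≤ s * (j * 4) + s * 3) :
    a * b ≤ (k - 1) * (2 * k - 4) * (n - (k - 1) * (2 * k - 3)) := by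
  have h₁ : s * (j * 4) + s * 3 ≤ (k - 1 - j) * (j * 4 + 3) := by nlinarith
  have h₂ : (k - 1 - j) * (j * 4 + 3) ≤ (k - 1) * (2 * k - 4) := by
    nlinarith [sq_nonneg (4 * (k - 1 - 2 * j) - 3)]
  have ha' : a ≤ (k - 1) * (2 * k - 4) := by linarith
  obtain rfl : b = n - (k - 1) - a := by linarith
  have h₃ : 0 ≤ n - (k - 1) - a - (k - 1) * (2 * k - 4) := by nlinarith
  nlinarith [mul_nonneg (sub_nonneg.2 ha') h₃]

/-- In the saturation game `(n, C_k)`, for every `k ≥ 5` and all large `n`, Max (moving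
first or second) can guarantee a final score of at least
`C(n,2) - (k-1)(2k-4)[n - (k-1)(2k-3)]`. -/
theorem statement_1 (k : ℕ) (hk : 5 ≤ k) :
    ∃ n0 : ℕ, ∀ n : ℕ, n0 ≤ n → ∀ turn : Bool,
      GameEnsures (kConnectedProp k)
        (fun G : SimpleGraph (Fin n) =>
          (n.choose 2 : ℤ) - ((k : ℤ) - 1) * (2 * (k : ℤ) - 4) *
              ((n : ℤ) - ((k : ℤ) - 1) * (2 * (k : ℤ) - 3)) ≤ (G.edgeSet.ncard : ℤ))
        turn ⊥ := by
  refine ⟨k + k * 4 * (3 * k * k + 1), fun n hn turn => ?_⟩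
  obtain ⟨m, r, hm, hr, hnmr⟩ : ∃ m r, 3 * k * k + 1 ≤ m ∧ r < k * 4 ∧
      n = k + (m * (k * 4) + r) := by
    refine ⟨(n - k) / (k * 4), (n - k) % (k * 4), ?_, Nat.mod_lt _ (by omega), ?_⟩
    · rw [Nat.le_div_iff_mul_le (by omega), mul_comm]
      omega
    · have := Nat.div_add_mod' (n - k) (k * 4)
      omega
  let e : HubVertex k m r ≃ Fin n := Fintype.equivOfCardEq (by simp [hnmr])
  let i₀ : Fin k := ⟨0, by omega⟩
  let E : Finset (Sym2 (Fin n)) := (HubVertex.edges i₀).image (Sym2.map e)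
  have hEcard : E.card ≤ m * (k * 4) + m * (k - 1) + r * k :=
    Finset.card_image_le.trans (HubVertex.card_edges_le i₀)
  have hE : ∀ x ∈ E, ¬ x.IsDiag := by
    intro x hx
    obtain ⟨y, hy, rfl⟩ := Finset.mem_image.1 hx
    rw [Sym2.isDiag_map e.injective]
    exact HubVertex.not_isDiag_of_mem_edges hy
  have hbudget : 2 * (2 * E.card + 1) < k * n := by
    obtain ⟨k', rfl⟩ : ∃ k', k = k' + 5 := ⟨k - 5, by omega⟩
    subst hnmr
    rw [show k' + 5 - 1 = k' + 4 by omega] at hEcard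
    nlinarith [Nat.zero_le (m * k'), Nat.zero_le (m * k' * k'), Nat.zero_le (r * k')]
  have hnk : 2 * (k * (2 * k)) ≤ n := by nlinarith
  have hkn : k < Fintype.card (Fin n) := by
    rw [Fintype.card_fin]
    nlinarith
  have hτ : ∀ G : SimpleGraph (Fin n), G.edgeSet.ncard ≤ 2 * E.card + 1 →
      ¬ kConnectedProp k G := fun G hG =>
    not_kConnectedProp_of_edgeSet_ncard (by rw [Fintype.card_fin]; omega)
  refine gameEnsures_of_forcing hE hτ ?_ _ turn ⊥ le_rfl (hτ ⊥ (by simp)) (Or.inr ?_)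
  · intro G hG hsat hsub
    obtain ⟨A, B, hAB, hA, hB, hsep, hcard⟩ := exists_separation_of_not_kConnectedProp hkn hG
    have hscore := choose_two_le_of_saturated (by omega) hAB hA hB hsep hcard hsat
    have hsum : A.card + B.card = n - (k - 1) := by
      rw [← Finset.card_union_of_disjoint hAB, ← hcard, Finset.card_compl, Fintype.card_fin]
      have := Finset.card_le_univ (A ∪ B)
      rw [Fintype.card_fin] at this
      omega
    have hG' : ↑(HubVertex.edges i₀ : Finset (Sym2 (HubVertex k m r))) ⊆
        (G.comap e).edgeSet := by
      intro x hx
      have hx' : Sym2.map e x ∈ G.edgeSet := hsub (Finset.mem_coe.2 (Finset.mem_image_of_mem _ hx))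
      induction x with
      | _ x y => exact hx'
    have hcompl : ((A.map e.symm.toEmbedding ∪ B.map e.symm.toEmbedding)ᶜ).card = k - 1 := by
      rw [← hcard, ← Finset.map_union, Finset.card_compl, Finset.card_compl, Finset.card_map,
        Fintype.card_congr e]
    obtain ⟨s, j, hsj, hle⟩ := HubVertex.exists_card_side_le hG' (by nlinarith)
      (A := A.map e.symm.toEmbedding) (B := B.map e.symm.toEmbedding)
      ((Finset.disjoint_map _).2 hAB) (fun x hx y hy hxy =>
        hsep _ (Finset.mem_map_equiv.1 hx) _ (Finset.mem_map_equiv.1 hy) hxy) (by omega)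
    rw [hcompl] at hsj
    rw [Finset.card_map, Finset.card_map] at hle
    rw [Fintype.card_fin] at hscore hkn
    have hprod : (A.card : ℤ) * B.card ≤ ((k : ℤ) - 1) * (2 * (k : ℤ) - 4) *
        ((n : ℤ) - ((k : ℤ) - 1) * (2 * (k : ℤ) - 3)) := by
      rcases hle with hle | hle
      · exact mul_side_le (s := s) (j := j) (by omega) (by exact_mod_cast hnk) (by omega)
          (by omega) (by omega) (by exact_mod_cast hle)
      · rw [mul_comm]
        exact mul_side_le (s := s) (j := j) (by omega) (by exact_mod_cast hnk) (by omega)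
          (by omega) (by omega) (by exact_mod_cast hle)
    have hscore' : (n.choose 2 : ℤ) ≤ G.edgeSet.ncard + (A.card : ℤ) * B.card := by
      exact_mod_cast hscore
    linarith
  · simp only [SimpleGraph.edgeSet_bot, Set.ncard_empty, Set.sdiff_empty, Set.ncard_coe_finset]
    split <;> omega
end
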